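/- There is an absolute constant C > 0 such that for every d ∈ ℕ, every n ∈ ℕ and every d-homogeneous function f : {-1,1}^n → ℝ (i.e. f̂(S) = 0 whenever |S| ≠ d), one has (∑_{S ⊆ [n], |S| = d} |f̂(S)|^{2d/(d+1)})^{(d+1)/(2d)} ≤ C^{√(d·log d)} · ‖f‖_∞. -/

import Mathlib

open Finset

/-- The Walsh character `χ_S(x) = ∏_{k ∈ S} x_k` on the Boolean cube `{-1,1}^n`,
where a point of the cube is encoded as `x : Fin n → Bool` (`true ↦ 1`, `false ↦ -1`). -/
noncomputable def walsh {n : ℕ} (S : Finset (Fin n)) (x : Fin n → Bool) : ℝ :=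
  ∏ k ∈ S, (if x k then (1 : ℝ) else -1)

/-- The Fourier–Walsh coefficient `f̂(S) = 2^{-n} ∑_x f(x) χ_S(x)`. -/
noncomputable def walshCoeff {n : ℕ} (f : (Fin n → Bool) → ℝ) (S : Finset (Fin n)) : ℝ :=
  (∑ x : Fin n → Bool, f x * walsh S x) / 2 ^ n

/-- The sup norm `‖f‖_∞ = max_x |f(x)|` on the Boolean cube. -/
noncomputable def supNorm {n : ℕ} (f : (Fin n → Bool) → ℝ) : ℝ :=
  ⨆ x : Fin n → Bool, |f x|


section CoeffBound

open Polynomial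

lemma iterate_derivative_comp_C_mul_X_sub_one (a : ℝ) (q : ℝ[X]) (j : ℕ) :
    derivative^[j] (q.comp (C a * (X - 1))) =
      C (a ^ j) * (derivative^[j] q).comp (C a * (X - 1)) := by
  induction j with
  | zero => simp
  | succ j ih =>
    rw [Function.iterate_succ_apply', ih, derivative_C_mul, derivative_comp,
      Function.iterate_succ_apply', pow_succ, C_mul]
    simp only [derivative_mul, derivative_C, derivative_sub, derivative_X, derivative_one]
    ring

lemma iterate_derivative_T_eval_one_le (d j : ℕ) :
    (derivative^[j] (Chebyshev.T ℝ d)).eval 1 ≤ (d : ℝ) ^ (2 * j) := by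
  have hnn : ∀ j, 0 ≤ (derivative^[j] (Chebyshev.T ℝ d)).eval 1 := fun j => by
    simpa using Chebyshev.eval_iterate_derivative_le_of_forall_abs_le_one (n := d) (P := 0)
      (k := j) le_rfl (by simp) (by simp)
  induction j with
  | zero => simp
  | succ j ih =>
    have h := Chebyshev.iterate_derivative_T_eval_one_recurrence (R := ℝ) d j
    push_cast at h
    have h1 := hnn j
    have h2 := hnn (j + 1)
    calc (derivative^[j + 1] (Chebyshev.T ℝ d)).eval 1
        ≤ (2 * j + 1) * (derivative^[j + 1] (Chebyshev.T ℝ d)).eval 1 := by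
          nlinarith [mul_nonneg (Nat.cast_nonneg (α := ℝ) j) h2]
      _ ≤ (d : ℝ) ^ 2 * (derivative^[j] (Chebyshev.T ℝ d)).eval 1 := by
          rw [h]; exact mul_le_mul_of_nonneg_right (by nlinarith [sq_nonneg (j : ℝ)]) h1
      _ ≤ (d : ℝ) ^ 2 * (d : ℝ) ^ (2 * j) := by gcongr
      _ = _ := by ring

lemma one_add_two_div_pow_le (d : ℕ) (hd : 1 ≤ d) : (1 + 2 / (d : ℝ)) ^ d ≤ 9 := by
  have hd' : (0 : ℝ) < d := by exact_mod_cast hd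
  calc (1 + 2 / (d : ℝ)) ^ d ≤ (Real.exp (2 / d)) ^ d := by
        gcongr; linarith [Real.add_one_le_exp (2 / (d : ℝ))]
    _ = Real.exp 1 ^ 2 := by
        rw [← Real.exp_nat_mul, ← Real.exp_nat_mul]; congr 1; field_simp; norm_num
    _ ≤ 3 ^ 2 := by gcongr; linarith [Real.exp_one_lt_d9]
    _ = 9 := by norm_num

/-- A polynomial of degree `d` growing no faster than `(1 + |t|)^d` has `j`-th coefficient at
most `9 d^{3j}`. -/
lemma coeff_le_of_abs_eval_le (d : ℕ) (hd : 1 ≤ d) (q : ℝ[X]) (hq : q.natDegree ≤ d)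
    (hb : ∀ t : ℝ, |q.eval t| ≤ (1 + |t|) ^ d) (j : ℕ) :
    q.coeff j ≤ 9 * (d : ℝ) ^ (3 * j) := by
  have hd' : (0 : ℝ) < d := by exact_mod_cast hd
  set Q : ℝ[X] := C (1 / 9) * q.comp (C (1 / (d : ℝ)) * (X - 1)) with hQ
  have hdeg : Q.degree ≤ d := by
    refine (degree_le_natDegree).trans ?_
    norm_cast
    refine (natDegree_C_mul_le _ _).trans (natDegree_comp_le.trans ?_)
    have : (C (1 / (d : ℝ)) * (X - 1) : ℝ[X]).natDegree ≤ 1 := by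
      refine (natDegree_C_mul_le _ _).trans ?_
      simpa using natDegree_X_sub_C_le (1 : ℝ)
    calc _ ≤ q.natDegree * 1 := Nat.mul_le_mul_left _ this
      _ ≤ d := by simpa using hq
  have hbnd : ∀ x ∈ Set.Icc (-1 : ℝ) 1, |Q.eval x| ≤ 1 := by
    intro x hx
    have h1 : Q.eval x = 1 / 9 * q.eval (1 / d * (x - 1)) := by simp [hQ, eval_comp]
    have h2 := hb (1 / d * (x - 1))
    have h3 : |1 / (d : ℝ) * (x - 1)| ≤ 2 / d := by
      rw [abs_mul, abs_of_pos (by positivity), div_mul_eq_mul_div, one_mul]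
      gcongr
      rw [abs_le]; constructor <;> linarith [hx.1, hx.2]
    have h4 : (1 + |1 / (d : ℝ) * (x - 1)|) ^ d ≤ 9 :=
      le_trans (by gcongr) (one_add_two_div_pow_le d hd)
    rw [h1, abs_mul, abs_of_pos (by norm_num : (0 : ℝ) < 1 / 9)]
    linarith
  have key := (Chebyshev.eval_iterate_derivative_le_of_forall_abs_le_one (k := j) (x := 1) le_rfl
    hdeg hbnd).trans (iterate_derivative_T_eval_one_le d j)
  rw [hQ, iterate_derivative_C_mul, iterate_derivative_comp_C_mul_X_sub_one] at key
  have h0 : (derivative^[j] q).eval 0 = (j.factorial : ℝ) * q.coeff j := by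
    rw [← coeff_zero_eq_eval_zero, coeff_iterate_derivative]
    simp [Nat.descFactorial_self]
  simp only [eval_mul, eval_C, eval_comp, eval_sub, eval_X, eval_one, sub_self, mul_zero, h0]
    at key
  rcases le_or_gt (q.coeff j) 0 with hneg | hpos
  · exact hneg.trans (by positivity)
  · have hf : (1 : ℝ) ≤ j.factorial := by exact_mod_cast Nat.factorial_pos j
    calc q.coeff j ≤ j.factorial * q.coeff j := le_mul_of_one_le_left hpos.le hf
      _ = 9 * (d : ℝ) ^ j * (1 / 9 * ((1 / (d : ℝ)) ^ j * (j.factorial * q.coeff j))) := by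
          rw [one_div (d : ℝ), inv_pow]; field_simp
      _ ≤ 9 * (d : ℝ) ^ j * (d : ℝ) ^ (2 * j) := by gcongr
      _ = _ := by ring

lemma abs_coeff_le_of_abs_eval_le (d : ℕ) (hd : 1 ≤ d) (q : ℝ[X])
    (hq : q.natDegree ≤ d) (hb : ∀ t : ℝ, |q.eval t| ≤ (1 + |t|) ^ d) (j : ℕ) :
    |q.coeff j| ≤ 9 * (d : ℝ) ^ (3 * j) := by
  refine abs_le'.2 ⟨coeff_le_of_abs_eval_le d hd q hq hb j, ?_⟩
  rw [← coeff_neg]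
  exact coeff_le_of_abs_eval_le d hd (-q) (by simpa using hq) (by simpa using hb) j

end CoeffBound

section Hypercontractivity

variable {n : ℕ}

lemma walsh_insert {S : Finset (Fin n)} {i : Fin n} (hi : i ∉ S) (x : Fin n → Bool) :
    walsh (insert i S) x = walsh {i} x * walsh S x := by
  simp [walsh, prod_insert hi]

lemma walsh_sq (S : Finset (Fin n)) (x : Fin n → Bool) : walsh S x ^ 2 = 1 := by
  rw [walsh, ← prod_pow]
  exact prod_eq_one fun i _ => by split_ifs <;> norm_num

/-- Flipping the `i`-th bit, as an equivalence of the cube. -/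
def flipBit (i : Fin n) : (Fin n → Bool) ≃ (Fin n → Bool) :=
  Function.Involutive.toPerm (fun x => Function.update x i (!x i)) fun x => by simp

lemma flipBit_apply (i : Fin n) (x : Fin n → Bool) :
    flipBit i x = Function.update x i (!x i) := rfl

lemma walsh_flipBit_of_notMem {S : Finset (Fin n)} {i : Fin n} (hi : i ∉ S)
    (x : Fin n → Bool) : walsh S (flipBit i x) = walsh S x := by
  refine prod_congr rfl fun k hk => ?_
  rw [flipBit_apply, Function.update_of_ne (by rintro rfl; exact hi hk)]

lemma walsh_singleton_flipBit (i : Fin n) (x : Fin n → Bool) :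
    walsh {i} (flipBit i x) = -walsh {i} x := by
  simp only [walsh, prod_singleton, flipBit_apply, Function.update_self]
  cases x i <;> simp

lemma sum_eq_half_sum_flipBit (i : Fin n) (F : (Fin n → Bool) → ℝ) :
    ∑ x, F x = ∑ x, (F x + F (flipBit i x)) / 2 := by
  rw [← sum_div, sum_add_distrib, Equiv.sum_comp (flipBit i) F]
  ring

lemma walshSum_insert {i : Fin n} {s : Finset (Fin n)} (hi : i ∉ s) (c : Finset (Fin n) → ℝ)
    (x : Fin n → Bool) :
    ∑ S ∈ (insert i s).powerset, c S * walsh S x =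
      ∑ S ∈ s.powerset, c S * walsh S x +
        walsh {i} x * ∑ S ∈ s.powerset, c (insert i S) * walsh S x := by
  rw [sum_powerset_insert hi, mul_sum]
  congr 1
  refine sum_congr rfl fun S hS => ?_
  rw [walsh_insert fun h => hi (mem_powerset.1 hS h)]
  ring

lemma walshSum_flipBit {i : Fin n} {s : Finset (Fin n)} (hi : i ∉ s) (c : Finset (Fin n) → ℝ)
    (x : Fin n → Bool) :
    ∑ S ∈ s.powerset, c S * walsh S (flipBit i x) = ∑ S ∈ s.powerset, c S * walsh S x :=
  sum_congr rfl fun S hS => by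
    rw [walsh_flipBit_of_notMem fun h => hi (mem_powerset.1 hS h)]

lemma parseval_powerset (s : Finset (Fin n)) (c : Finset (Fin n) → ℝ) :
    ∑ x : Fin n → Bool, (∑ S ∈ s.powerset, c S * walsh S x) ^ 2 =
      2 ^ n * ∑ S ∈ s.powerset, c S ^ 2 := by
  induction s using Finset.induction_on generalizing c with
  | empty => simp [walsh]
  | insert i s hi ih =>
    rw [sum_eq_half_sum_flipBit i, sum_powerset_insert hi, mul_add, ← ih, ← ih,
      ← sum_add_distrib]
    refine sum_congr rfl fun x _ => ?_
    rw [walshSum_insert hi, walshSum_insert hi, walshSum_flipBit hi, walshSum_flipBit hi,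
      walsh_singleton_flipBit]
    linear_combination (∑ S ∈ s.powerset, c (insert i S) * walsh S x) ^ 2 * walsh_sq {i} x

/-- The `(2, 4)`-hypercontractive inequality of Bonami. -/
lemma bonami_powerset (s : Finset (Fin n)) (c : Finset (Fin n) → ℝ) :
    ∑ x : Fin n → Bool, (∑ S ∈ s.powerset, c S * walsh S x) ^ 4 ≤
      2 ^ n * (∑ S ∈ s.powerset, 3 ^ S.card * c S ^ 2) ^ 2 := by
  induction s using Finset.induction_on generalizing c with
  | empty => simp [walsh, ← pow_mul]
  | insert i s hi ih =>
    set g : (Fin n → Bool) → ℝ := fun x => ∑ S ∈ s.powerset, c S * walsh S x with hg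
    set h : (Fin n → Bool) → ℝ := fun x => ∑ S ∈ s.powerset, c (insert i S) * walsh S x with hh
    set A := ∑ S ∈ s.powerset, 3 ^ S.card * c S ^ 2 with hA
    set B := ∑ S ∈ s.powerset, 3 ^ S.card * c (insert i S) ^ 2 with hB
    have hA0 : 0 ≤ A := sum_nonneg fun _ _ => by positivity
    have hB0 : 0 ≤ B := sum_nonneg fun _ _ => by positivity
    have e1 : ∑ x : Fin n → Bool, (∑ S ∈ (insert i s).powerset, c S * walsh S x) ^ 4 =
        ∑ x, g x ^ 4 + 6 * ∑ x, g x ^ 2 * h x ^ 2 + ∑ x, h x ^ 4 := by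
      rw [sum_eq_half_sum_flipBit i, mul_sum, ← sum_add_distrib, ← sum_add_distrib]
      refine sum_congr rfl fun x _ => ?_
      rw [walshSum_insert hi, walshSum_insert hi, walshSum_flipBit hi, walshSum_flipBit hi,
        walsh_singleton_flipBit]
      change ((g x + walsh {i} x * h x) ^ 4 + (g x + -walsh {i} x * h x) ^ 4) / 2 = _
      linear_combination (6 * g x ^ 2 * h x ^ 2 + h x ^ 4 * (walsh {i} x ^ 2 + 1)) *
        walsh_sq {i} x
    have e2 : ∑ S ∈ (insert i s).powerset, 3 ^ S.card * c S ^ 2 = A + 3 * B := by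
      rw [sum_powerset_insert hi, hB, mul_sum]
      congr 1
      refine sum_congr rfl fun S hS => ?_
      rw [card_insert_of_notMem fun h => hi (mem_powerset.1 hS h)]
      ring
    have cs := sum_mul_sq_le_sq_mul_sq univ (fun x => g x ^ 2) (fun x => h x ^ 2)
    simp only [← pow_mul] at cs
    norm_num at cs
    have ihg : ∑ x, g x ^ 4 ≤ 2 ^ n * A ^ 2 := ih c
    have ihh : ∑ x, h x ^ 4 ≤ 2 ^ n * B ^ 2 := ih fun S => c (insert i S)
    have cross : ∑ x, g x ^ 2 * h x ^ 2 ≤ 2 ^ n * (A * B) := by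
      refine le_of_sq_le_sq ?_ (by positivity)
      calc (∑ x, g x ^ 2 * h x ^ 2) ^ 2 ≤ (∑ x, g x ^ 4) * ∑ x, h x ^ 4 := cs
        _ ≤ (2 ^ n * A ^ 2) * (2 ^ n * B ^ 2) :=
            mul_le_mul ihg ihh (sum_nonneg fun _ _ => by positivity) (by positivity)
        _ = _ := by ring
    rw [e1, e2]
    nlinarith [mul_nonneg (pow_nonneg (zero_le_two (α := ℝ)) n) (mul_nonneg hB0 hB0)]

lemma parseval (c : Finset (Fin n) → ℝ) :
    ∑ x : Fin n → Bool, (∑ S, c S * walsh S x) ^ 2 = 2 ^ n * ∑ S, c S ^ 2 := by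
  simpa using parseval_powerset univ c

/-- Bonami's inequality for polynomials of degree at most `d`. -/
lemma bonami (d : ℕ) (c : Finset (Fin n) → ℝ) (hc : ∀ S, d < S.card → c S = 0) :
    ∑ x : Fin n → Bool, (∑ S, c S * walsh S x) ^ 4 ≤ 2 ^ n * (9 ^ d * (∑ S, c S ^ 2) ^ 2) := by
  have h := bonami_powerset univ c
  simp only [powerset_univ] at h
  refine h.trans ?_
  have h1 : ∑ S, 3 ^ S.card * c S ^ 2 ≤ 3 ^ d * ∑ S, c S ^ 2 := by
    rw [mul_sum]
    refine sum_le_sum fun S _ => ?_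
    rcases le_or_gt S.card d with hS | hS
    · gcongr; norm_num
    · simp [hc S hS]
  have h0 : 0 ≤ ∑ S, (3 : ℝ) ^ S.card * c S ^ 2 := sum_nonneg fun _ _ => by positivity
  calc _ ≤ 2 ^ n * (3 ^ d * ∑ S, c S ^ 2) ^ 2 := by gcongr
    _ = _ := by rw [mul_pow, ← pow_mul, mul_comm d 2, pow_mul]; norm_num

end Hypercontractivity

section Holder

/-- Hölder's inequality with exponents `(m + 1) / m` and `m + 1`. -/
lemma sum_rpow_mul_rpow_pow_le {ι : Type*} (s : Finset ι) (u w : ι → ℝ) (hu : ∀ i ∈ s, 0 ≤ u i)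
    (hw : ∀ i ∈ s, 0 ≤ w i) (m : ℕ) (hm : 1 ≤ m) :
    (∑ i ∈ s, u i ^ ((m : ℝ) / (m + 1)) * w i ^ ((1 : ℝ) / (m + 1))) ^ (m + 1) ≤
      (∑ i ∈ s, u i) ^ m * ∑ i ∈ s, w i := by
  have hm' : (0 : ℝ) < m := by exact_mod_cast hm
  have hpq : Real.HolderConjugate (((m : ℝ) + 1) / m) (m + 1) := by
    rw [Real.holderConjugate_iff]
    constructor
    · rw [lt_div_iff₀ hm']; linarith
    · field_simp
  have h := Real.inner_le_Lp_mul_Lq_of_nonneg s hpq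
    (f := fun i => u i ^ ((m : ℝ) / (m + 1))) (g := fun i => w i ^ ((1 : ℝ) / (m + 1)))
    (fun i hi => Real.rpow_nonneg (hu i hi) _) (fun i hi => Real.rpow_nonneg (hw i hi) _)
  have e1 : ∑ i ∈ s, (u i ^ ((m : ℝ) / (m + 1))) ^ (((m : ℝ) + 1) / m) = ∑ i ∈ s, u i :=
    sum_congr rfl fun i hi => by
      rw [← Real.rpow_mul (hu i hi)]
      convert Real.rpow_one (u i) using 2
      field_simp
  have e2 : ∑ i ∈ s, (w i ^ ((1 : ℝ) / (m + 1))) ^ ((m : ℝ) + 1) = ∑ i ∈ s, w i :=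
    sum_congr rfl fun i hi => by
      rw [← Real.rpow_mul (hw i hi)]
      convert Real.rpow_one (w i) using 2
      field_simp
  rw [e1, e2] at h
  have hU : 0 ≤ ∑ i ∈ s, u i := sum_nonneg hu
  have hW : 0 ≤ ∑ i ∈ s, w i := sum_nonneg hw
  have h0 : 0 ≤ ∑ i ∈ s, u i ^ ((m : ℝ) / (m + 1)) * w i ^ ((1 : ℝ) / (m + 1)) :=
    sum_nonneg fun i hi => mul_nonneg (Real.rpow_nonneg (hu i hi) _) (Real.rpow_nonneg (hw i hi) _)
  refine (pow_le_pow_left₀ h0 h (m + 1)).trans (le_of_eq ?_)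
  rw [mul_pow, ← Real.rpow_mul_natCast hU, ← Real.rpow_mul_natCast hW]
  congr 1
  · rw [← Real.rpow_natCast]; congr 1; push_cast; field_simp
  · convert Real.rpow_one _ using 2; push_cast; field_simp

end Holder

section MomentComparison

variable {n : ℕ}

/-- For polynomials of degree at most `d`, the `L²` norm is controlled by the `L^p` norm with
`p = 2j/(j+1)`, up to a factor of the form `C^{d/j}`. -/
lemma sum_sq_rpow_le_avg_rpow (d j : ℕ) (hj : 1 ≤ j) (c : Finset (Fin n) → ℝ)
    (hc : ∀ S, d < S.card → c S = 0) :
    (∑ S, c S ^ 2) ^ ((j : ℝ) / (j + 1)) ≤ 9 ^ ((d : ℝ) / (j + 1)) *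
      ((∑ x : Fin n → Bool, |∑ S, c S * walsh S x| ^ ((2 * j : ℝ) / (j + 1))) / 2 ^ n) := by
  set g : (Fin n → Bool) → ℝ := fun x => ∑ S, c S * walsh S x with hg
  set l := ∑ S, c S ^ 2 with hl
  set E := ∑ x, |g x| ^ ((2 * j : ℝ) / (j + 1)) with hE
  have hl0 : 0 ≤ l := sum_nonneg fun _ _ => sq_nonneg _
  have hE0 : 0 ≤ E := sum_nonneg fun _ _ => by positivity
  have hj' : (0 : ℝ) < j := by exact_mod_cast hj
  have hN : (0 : ℝ) < 2 ^ n := by positivity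
  rcases hl0.eq_or_lt with h0 | hlpos
  · rw [← h0, Real.zero_rpow (by positivity)]
    positivity
  have holder := sum_rpow_mul_rpow_pow_le univ (fun x => |g x| ^ ((2 * j : ℝ) / (j + 1)))
    (fun x => g x ^ 4) (fun _ _ => by positivity) (fun _ _ => by positivity) (j + 1) (by lia)
  have e1 : ∑ x, (|g x| ^ ((2 * j : ℝ) / (j + 1))) ^ (((j + 1 : ℕ) : ℝ) / ((j + 1 : ℕ) + 1)) *
      (g x ^ 4) ^ ((1 : ℝ) / ((j + 1 : ℕ) + 1)) = 2 ^ n * l := by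
    rw [hl, ← parseval]
    refine sum_congr rfl fun x _ => ?_
    change _ = g x ^ 2
    rw [← Even.pow_abs (by decide : Even 4), ← Real.rpow_mul (abs_nonneg _), ← Real.rpow_natCast,
      ← Real.rpow_mul (abs_nonneg _), ← Real.rpow_add_of_nonneg (abs_nonneg _) (by positivity)
        (by positivity), ← sq_abs, ← Real.rpow_natCast]
    congr 1
    push_cast
    field_simp
    ring
  rw [e1] at holder
  have hb := bonami d c hc
  have key : l ^ j ≤ 9 ^ d * (E / 2 ^ n) ^ (j + 1) := by
    have h1 : (2 ^ n * l) ^ (j + 1 + 1) ≤ E ^ (j + 1) * (2 ^ n * (9 ^ d * l ^ 2)) :=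
      holder.trans (by gcongr)
    rw [div_pow, mul_div_assoc', le_div_iff₀ (by positivity)]
    have h2 : (l ^ j * (2 ^ n) ^ (j + 1)) * (2 ^ n * l ^ 2) ≤
        (9 ^ d * E ^ (j + 1)) * (2 ^ n * l ^ 2) := by
      calc _ = (2 ^ n * l) ^ (j + 1 + 1) := by ring
        _ ≤ _ := h1
        _ = _ := by ring
    exact le_of_mul_le_mul_right h2 (by positivity)
  have h3 := Real.rpow_le_rpow (by positivity) key (z := 1 / ((j : ℝ) + 1)) (by positivity)
  rw [Real.mul_rpow (by positivity) (by positivity), ← Real.rpow_natCast, ← Real.rpow_natCast,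
    ← Real.rpow_natCast, ← Real.rpow_mul hl0, ← Real.rpow_mul (by positivity),
    ← Real.rpow_mul (by positivity)] at h3
  convert h3 using 2
  · ring
  · congr 1; ring
  · rw [show (((j + 1 : ℕ) : ℝ) * (1 / ((j : ℝ) + 1))) = 1 by push_cast; field_simp,
      Real.rpow_one]

end MomentComparison

section Polarization

variable {n : ℕ}

lemma walsh_eq_prod_univ (S : Finset (Fin n)) (x : Fin n → Bool) :
    walsh S x = ∏ i, if i ∈ S then (if x i then (1 : ℝ) else -1) else 1 := by
  rw [walsh, prod_ite_mem, univ_inter]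

/-- A multilinear polynomial bounded by `1` on the vertices of the cube is bounded by `1` on the
solid cube. -/
lemma abs_multilinear_le_one (a : Finset (Fin n) → ℝ)
    (ha : ∀ x, |∑ S, a S * walsh S x| ≤ 1) (t : Fin n → ℝ) (ht : ∀ i, |t i| ≤ 1) :
    |∑ S, a S * ∏ i ∈ S, t i| ≤ 1 := by
  set w : (Fin n → Bool) → ℝ := fun x => ∏ i, (1 + (if x i then (1 : ℝ) else -1) * t i) / 2 with hw
  have hw0 : ∀ x, 0 ≤ w x := fun x => prod_nonneg fun i _ => by
    have := abs_le.1 (ht i)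
    split_ifs <;> linarith
  have hmom : ∀ S : Finset (Fin n), ∑ x, w x * walsh S x = ∏ i ∈ S, t i := by
    intro S
    simp_rw [walsh_eq_prod_univ, hw, ← prod_mul_distrib]
    have := (Finset.prod_univ_sum (fun _ : Fin n => (univ : Finset Bool))
      (fun i b => (1 + (if b then (1 : ℝ) else -1) * t i) / 2 *
        if i ∈ S then (if b then (1 : ℝ) else -1) else 1)).symm
    rw [Fintype.piFinset_univ] at this
    rw [this, ← univ_inter S, ← prod_ite_mem]
    refine prod_congr rfl fun i _ => ?_
    simp only [Fintype.sum_bool, univ_inter]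
    by_cases h : i ∈ S <;> simp only [h, if_true, if_false, Bool.false_eq_true] <;> ring
  have hw1 : ∑ x, w x = 1 := by simpa [walsh] using hmom ∅
  have : ∑ S, a S * ∏ i ∈ S, t i = ∑ x, w x * ∑ S, a S * walsh S x := by
    simp_rw [← hmom, mul_sum]
    rw [sum_comm]
    exact sum_congr rfl fun x _ => sum_congr rfl fun S _ => by ring
  rw [this]
  calc |∑ x, w x * ∑ S, a S * walsh S x| ≤ ∑ x, |w x * ∑ S, a S * walsh S x| :=
        abs_sum_le_sum_abs _ _
    _ ≤ ∑ x, w x := sum_le_sum fun x _ => by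
        rw [abs_mul, abs_of_nonneg (hw0 x)]
        exact mul_le_of_le_one_right (hw0 x) (ha x)
    _ = 1 := hw1

open Polynomial in
/-- The `j`-homogeneous part of `x ↦ f (y + x)` is bounded by a constant polynomial in `d`,
for `f` a `d`-homogeneous function bounded by `1`. -/
lemma abs_sum_walsh_mul_derivative_le (d : ℕ) (hd : 1 ≤ d) (a : Finset (Fin n) → ℝ)
    (hhom : ∀ S, S.card ≠ d → a S = 0) (ha : ∀ x, |∑ S, a S * walsh S x| ≤ 1)
    (j : ℕ) (x y : Fin n → Bool) :
    |∑ J ∈ powersetCard j univ, (∑ S, (if J ⊆ S then a S else 0) * walsh S y) * walsh J x| ≤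
      9 * (d : ℝ) ^ (3 * j) := by
  set e : (Fin n → Bool) → Fin n → ℝ := fun x i => if x i then (1 : ℝ) else -1 with he
  have hee : ∀ (x : Fin n → Bool) i, |e x i| = 1 := fun x i => by simp only [he]; split_ifs <;> simp
  set q : ℝ[X] := ∑ S, C (a S * walsh S y) * ∏ i ∈ S, (1 + C (e x i) * X) with hq
  have hdeg : q.natDegree ≤ d := by
    refine natDegree_sum_le_of_forall_le _ _ fun S _ => ?_
    by_cases hS : S.card = d
    · refine (natDegree_C_mul_le _ _).trans ((natDegree_prod_le _ _).trans ?_)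
      rw [← hS, card_eq_sum_ones]
      refine sum_le_sum fun i _ => ?_
      compute_degree
    · simp [hhom S hS]
  have hbound : ∀ t : ℝ, |q.eval t| ≤ (1 + |t|) ^ d := by
    intro t
    have ht : 0 < 1 + |t| := by positivity
    have e1 : q.eval t = (1 + |t|) ^ d *
        ∑ S, a S * ∏ i ∈ S, (e y i * (1 + e x i * t) / (1 + |t|)) := by
      rw [hq, eval_finsetSum, mul_sum]
      refine sum_congr rfl fun S _ => ?_
      by_cases hS : S.card = d
      · rw [prod_div_distrib, prod_mul_distrib, prod_const, hS]
        simp only [eval_mul, eval_C, eval_prod, eval_add, eval_one, eval_X]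
        rw [show walsh S y = ∏ i ∈ S, e y i from rfl]
        field_simp
        simp only [mul_comm t]
      · simp [hhom S hS]
    rw [e1, abs_mul, abs_of_pos (pow_pos ht d)]
    refine mul_le_of_le_one_right (by positivity) (abs_multilinear_le_one a ha _ fun i => ?_)
    rw [abs_div, abs_mul, hee, one_mul, abs_of_pos ht, div_le_one ht]
    calc |1 + e x i * t| ≤ |1| + |e x i * t| := abs_add_le _ _
      _ = 1 + |t| := by rw [abs_mul, hee, one_mul, abs_one]
  have hcoeff : q.coeff j =
      ∑ J ∈ powersetCard j univ, (∑ S, (if J ⊆ S then a S else 0) * walsh S y) * walsh J x := by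
    have h1 : ∀ S : Finset (Fin n), (∏ i ∈ S, (1 + C (e x i) * X) : ℝ[X]).coeff j =
        ∑ J ∈ powersetCard j univ, if J ⊆ S then walsh J x else 0 := by
      intro S
      rw [prod_one_add, finsetSum_coeff, ← sum_filter]
      have : ∀ J : Finset (Fin n), (∏ i ∈ J, C (e x i) * X : ℝ[X]).coeff j =
          if J.card = j then walsh J x else 0 := by
        intro J
        rw [prod_mul_distrib, prod_const, ← map_prod, coeff_C_mul_X_pow]
        simp only [eq_comm]
        rfl
      simp_rw [this]
      rw [← sum_filter]
      refine sum_congr ?_ fun _ _ => rfl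
      ext J
      simp [and_comm]
    rw [hq, finsetSum_coeff]
    simp_rw [coeff_C_mul, h1, mul_sum, sum_mul]
    rw [sum_comm]
    refine sum_congr rfl fun J _ => sum_congr rfl fun S _ => ?_
    split_ifs <;> ring
  rw [← hcoeff]
  exact abs_coeff_le_of_abs_eval_le d hd q hdeg hbound j

end Polarization

section Recursion

/-- The Bohnenblust–Hille inequality for `d`-homogeneous functions on Boolean cubes, in the form
`∑ |f̂(S)|^{2d/(d+1)} ≤ B` for all `f` bounded by `1`. -/
def BHBound (d : ℕ) (B : ℝ) : Prop :=
  ∀ (n : ℕ) (a : Finset (Fin n) → ℝ), (∀ S, S.card ≠ d → a S = 0) →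
    (∀ x, |∑ S, a S * walsh S x| ≤ 1) → ∑ S, |a S| ^ ((2 * d : ℝ) / (d + 1)) ≤ B

lemma two_mul_div_add_one_pos {d : ℕ} (hd : 1 ≤ d) : (0 : ℝ) < (2 * d : ℝ) / (d + 1) := by
  have : (0 : ℝ) < d := by exact_mod_cast hd
  positivity

lemma two_mul_div_add_one_le_two (d : ℕ) : (2 * d : ℝ) / (d + 1) ≤ 2 := by
  rw [div_le_iff₀ (by positivity)]; linarith

lemma bhBound_one : BHBound 1 1 := by
  intro n a hhom ha
  have hx := ha fun i => decide (0 ≤ a {i})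
  have e : ∀ S : Finset (Fin n),
      a S * walsh S (fun i => decide (0 ≤ a {i})) = |a S| ^ ((2 * (1 : ℕ) : ℝ) / ((1 : ℕ) + 1)) := by
    intro S
    rw [show ((2 * (1 : ℕ) : ℝ) / ((1 : ℕ) + 1)) = 1 by norm_num, Real.rpow_one]
    by_cases hS : S.card = 1
    · obtain ⟨i, rfl⟩ := card_eq_one.1 hS
      simp only [walsh, prod_singleton, decide_eq_true_eq]
      split_ifs with h
      · rw [abs_of_nonneg h, mul_one]
      · rw [abs_of_neg (not_le.1 h)]; ring
    · simp [hhom S hS]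
  simp only [e] at hx
  exact (le_abs_self _).trans hx

/-- The mixed `ℓ_{2j/(j+1)}(ℓ_2)` norm of the coefficients, controlled by the
Bohnenblust–Hille inequality in degree `j`. -/
lemma BHBound.sum_mixed_le {j : ℕ} {B : ℝ} (hB : BHBound j B) (hj : 1 ≤ j) {d n : ℕ}
    (hd : 1 ≤ d) (a : Finset (Fin n) → ℝ) (hhom : ∀ S, S.card ≠ d → a S = 0)
    (ha : ∀ x, |∑ S, a S * walsh S x| ≤ 1) :
    ∑ J ∈ powersetCard j univ, (∑ S, if J ⊆ S then a S ^ 2 else 0) ^ ((j : ℝ) / (j + 1)) ≤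
      9 ^ ((d : ℝ) / (j + 1)) * ((9 * (d : ℝ) ^ (3 * j)) ^ 2 * B) := by
  set K : ℝ := 9 * (d : ℝ) ^ (3 * j) with hK
  have hd' : (1 : ℝ) ≤ d := by exact_mod_cast hd
  have hK1 : 1 ≤ K := by
    have : (1 : ℝ) ≤ (d : ℝ) ^ (3 * j) := one_le_pow₀ hd'
    linarith
  have hK0 : 0 < K := by linarith
  set h : Finset (Fin n) → (Fin n → Bool) → ℝ :=
    fun J y => ∑ S, (if J ⊆ S then a S else 0) * walsh S y with hh
  have hp0 := two_mul_div_add_one_pos hj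
  have hp2 := two_mul_div_add_one_le_two j
  have hpoint : ∀ y, ∑ J ∈ powersetCard j univ, |h J y| ^ ((2 * j : ℝ) / (j + 1)) ≤ K ^ 2 * B := by
    intro y
    have h1 := hB n (fun J => if J.card = j then h J y / K else 0) (fun J hJ => if_neg hJ) (by
      intro x
      have h2 := abs_sum_walsh_mul_derivative_le d hd a hhom ha j x y
      have h3 : ∑ J, (if J.card = j then h J y / K else 0) * walsh J x =
          (∑ J ∈ powersetCard j univ, h J y * walsh J x) / K := by
        rw [powersetCard_eq_filter, powerset_univ, sum_filter, sum_div]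
        refine sum_congr rfl fun J _ => ?_
        split_ifs <;> ring
      rw [h3, abs_div, abs_of_pos hK0, div_le_one hK0]
      exact h2)
    have h4 : ∑ J, |if J.card = j then h J y / K else 0| ^ ((2 * j : ℝ) / (j + 1)) =
        (∑ J ∈ powersetCard j univ, |h J y| ^ ((2 * j : ℝ) / (j + 1))) /
          K ^ ((2 * j : ℝ) / (j + 1)) := by
      rw [powersetCard_eq_filter, powerset_univ, sum_filter, sum_div]
      refine sum_congr rfl fun J _ => ?_
      split_ifs
      · rw [abs_div, abs_of_pos hK0, Real.div_rpow (abs_nonneg _) hK0.le]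
      · rw [abs_zero, Real.zero_rpow hp0.ne', zero_div]
    rw [h4, div_le_iff₀ (by positivity)] at h1
    have hsum : 0 ≤ ∑ J ∈ powersetCard j univ, |h J y| ^ ((2 * j : ℝ) / (j + 1)) :=
      sum_nonneg fun _ _ => by positivity
    have hKp : 0 < K ^ ((2 * j : ℝ) / (j + 1)) := by positivity
    have hB0 : 0 ≤ B := by
      by_contra hneg
      nlinarith
    calc _ ≤ B * K ^ ((2 * j : ℝ) / (j + 1)) := h1
      _ ≤ B * K ^ (2 : ℝ) := by gcongr
      _ = K ^ 2 * B := by rw [Real.rpow_two, mul_comm]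
  have hmoment : ∀ J : Finset (Fin n), (∑ S, if J ⊆ S then a S ^ 2 else 0) ^ ((j : ℝ) / (j + 1)) ≤
      9 ^ ((d : ℝ) / (j + 1)) * ((∑ x, |h J x| ^ ((2 * j : ℝ) / (j + 1))) / 2 ^ n) := by
    intro J
    have h1 := sum_sq_rpow_le_avg_rpow d j hj (fun S => if J ⊆ S then a S else 0) (by
      intro S hS
      simp [hhom S hS.ne'])
    simpa only [ite_pow, ne_eq, OfNat.ofNat_ne_zero, not_false_eq_true, zero_pow] using h1
  calc _ ≤ ∑ J ∈ powersetCard j univ,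
        9 ^ ((d : ℝ) / (j + 1)) * ((∑ x, |h J x| ^ ((2 * j : ℝ) / (j + 1))) / 2 ^ n) :=
        sum_le_sum fun J _ => hmoment J
    _ = 9 ^ ((d : ℝ) / (j + 1)) *
        ((∑ x, ∑ J ∈ powersetCard j univ, |h J x| ^ ((2 * j : ℝ) / (j + 1))) / 2 ^ n) := by
        rw [← mul_sum, ← sum_div, sum_comm]
    _ ≤ 9 ^ ((d : ℝ) / (j + 1)) * ((∑ _x : Fin n → Bool, K ^ 2 * B) / 2 ^ n) := by
        gcongr with x
        exact hpoint x
    _ = _ := by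
        congr 1
        simp only [sum_const, card_univ, Fintype.card_fun, Fintype.card_bool, Fintype.card_fin,
          nsmul_eq_mul]
        push_cast
        field_simp

/-- Splitting `d`-sets into blocks with sizes in `[k, 2k)` turns weights on the blocks into a weight
on `d`-sets. -/
lemma exists_block_weight {n k : ℕ} (hk : 1 ≤ k) {L : ℝ} (hL : 1 ≤ L) (v : Finset (Fin n) → ℝ)
    (hv : ∀ J, 0 ≤ v J)
    (hvL : ∀ j ∈ Ico k (2 * k), ∑ J ∈ powersetCard j univ, v J ^ j ≤ L) (d : ℕ) (hd : k ≤ d) :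
    ∃ V : Finset (Fin n) → ℝ, (∀ S, 0 ≤ V S) ∧ ∑ S ∈ powersetCard d univ, V S ^ d ≤ L ^ d ∧
      ∀ S, S.card = d → (∀ J ⊆ S, J.card ∈ Ico k (2 * k) → 0 < v J) →
        0 < V S ∧ (V S)⁻¹ ≤ ∑ J ∈ S.powerset with J.card ∈ Ico k (2 * k), (v J)⁻¹ := by
  induction d using Nat.strong_induction_on with
  | _ d ih =>
  rcases lt_or_ge d (2 * k) with hlt | hge
  · have hmem : d ∈ Ico k (2 * k) := mem_Ico.2 ⟨hd, hlt⟩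
    refine ⟨v, hv, (hvL d hmem).trans (le_self_pow₀ hL (by lia)), fun S hS hpos => ?_⟩
    have hSm : S.card ∈ Ico k (2 * k) := hS ▸ hmem
    refine ⟨hpos S Subset.rfl hSm, ?_⟩
    exact single_le_sum (f := fun J => (v J)⁻¹) (fun J _ => inv_nonneg.2 (hv J))
      (mem_filter.2 ⟨mem_powerset.2 Subset.rfl, hSm⟩)
  · obtain ⟨e, rfl⟩ : ∃ e, d = k + e := ⟨d - k, by lia⟩
    obtain ⟨W, hW0, hWL, hW⟩ := ih e (by lia) (by lia)
    have hchoice : ∀ S : Finset (Fin n), ∃ J ⊆ S, S.card = k + e → J.card = k := fun S => by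
      by_cases hS : S.card = k + e
      · obtain ⟨J, hJS, hJ⟩ := exists_subset_card_eq (show k ≤ S.card by lia)
        exact ⟨J, hJS, fun _ => hJ⟩
      · exact ⟨∅, empty_subset _, fun h => absurd h hS⟩
    choose F hFS hFk using hchoice
    have hk0 : (0 : ℝ) < k := by exact_mod_cast hk
    have he0 : (0 : ℝ) < e := by exact_mod_cast (by lia : 0 < e)
    have hde : (0 : ℝ) < (k + e : ℕ) := by exact_mod_cast (by lia : 0 < k + e)
    have hcardR : ∀ S : Finset (Fin n), S.card = k + e → (S \ F S).card = e := fun S hS => by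
      rw [card_sdiff_of_subset (hFS S), hS, hFk S hS]; lia
    refine ⟨fun S => v (F S) ^ ((k : ℝ) / (k + e : ℕ)) * W (S \ F S) ^ ((e : ℝ) / (k + e : ℕ)),
      fun S => mul_nonneg (Real.rpow_nonneg (hv _) _) (Real.rpow_nonneg (hW0 _) _), ?_, ?_⟩
    · have e1 : ∀ S : Finset (Fin n), (v (F S) ^ ((k : ℝ) / (k + e : ℕ)) *
          W (S \ F S) ^ ((e : ℝ) / (k + e : ℕ))) ^ (k + e) = v (F S) ^ k * W (S \ F S) ^ e := by
        intro S
        rw [mul_pow, ← Real.rpow_mul_natCast (hv _), ← Real.rpow_mul_natCast (hW0 _),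
          div_mul_cancel₀ _ hde.ne', div_mul_cancel₀ _ hde.ne', Real.rpow_natCast,
          Real.rpow_natCast]
      simp_rw [e1]
      have hinj : Set.InjOn (fun S : Finset (Fin n) => (F S, S \ F S))
          (powersetCard (k + e) (univ : Finset (Fin n))) := by
        intro S _ T _ hST
        simp only [Prod.mk.injEq] at hST
        rw [← union_sdiff_of_subset (hFS S), hST.2, hST.1, union_sdiff_of_subset (hFS T)]
      calc ∑ S ∈ powersetCard (k + e) univ, v (F S) ^ k * W (S \ F S) ^ e
          = ∑ P ∈ (powersetCard (k + e) univ).image (fun S => (F S, S \ F S)),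
              v P.1 ^ k * W P.2 ^ e :=
            (sum_image (f := fun P : Finset (Fin n) × Finset (Fin n) => v P.1 ^ k * W P.2 ^ e)
              hinj).symm
        _ ≤ ∑ P ∈ powersetCard k univ ×ˢ powersetCard e univ, v P.1 ^ k * W P.2 ^ e := by
            refine sum_le_sum_of_subset_of_nonneg ?_ fun P _ _ =>
              mul_nonneg (pow_nonneg (hv _) _) (pow_nonneg (hW0 _) _)
            intro P hP
            obtain ⟨S, hS, rfl⟩ := mem_image.1 hP
            have hS' := (mem_powersetCard.1 hS).2
            simp [mem_product, mem_powersetCard, hFk S hS', hcardR S hS']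
        _ = (∑ J ∈ powersetCard k univ, v J ^ k) * ∑ R ∈ powersetCard e univ, W R ^ e := by
            rw [sum_mul_sum, sum_product]
        _ ≤ L ^ k * L ^ e := by
            refine mul_le_mul ((hvL k (mem_Ico.2 ⟨le_rfl, by lia⟩)).trans
              (le_self_pow₀ hL (by lia))) hWL (sum_nonneg fun R _ => pow_nonneg (hW0 _) _)
              (by positivity)
        _ = L ^ (k + e) := (pow_add _ _ _).symm
    · intro S hS hpos
      have hFm : (F S).card ∈ Ico k (2 * k) := by
        rw [hFk S hS]; exact mem_Ico.2 ⟨le_rfl, by lia⟩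
      have hvpos := hpos (F S) (hFS S) hFm
      obtain ⟨hWpos, hWle⟩ := hW (S \ F S) (hcardR S hS)
        fun J hJ => hpos J (hJ.trans sdiff_subset)
      refine ⟨by positivity, ?_⟩
      set X := ∑ J ∈ S.powerset with J.card ∈ Ico k (2 * k), (v J)⁻¹ with hX
      have h1 : (v (F S))⁻¹ ≤ X :=
        single_le_sum (f := fun J => (v J)⁻¹) (fun J _ => inv_nonneg.2 (hv J))
          (mem_filter.2 ⟨mem_powerset.2 (hFS S), hFm⟩)
      have h2 : (W (S \ F S))⁻¹ ≤ X := hWle.trans <|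
        sum_le_sum_of_subset_of_nonneg
          (filter_subset_filter _ (powerset_mono.2 sdiff_subset))
          fun J _ _ => inv_nonneg.2 (hv J)
      have hsum1 : (k : ℝ) / (k + e : ℕ) + (e : ℝ) / (k + e : ℕ) = 1 := by
        push_cast; field_simp
      have amgm := Real.geom_mean_le_arith_mean2_weighted
        (w₁ := (k : ℝ) / (k + e : ℕ)) (w₂ := (e : ℝ) / (k + e : ℕ)) (by positivity) (by positivity)
        (inv_nonneg.2 hvpos.le) (inv_nonneg.2 hWpos.le) hsum1
      rw [mul_inv, ← Real.inv_rpow hvpos.le, ← Real.inv_rpow hWpos.le]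
      refine amgm.trans ?_
      calc _ ≤ (k : ℝ) / (k + e : ℕ) * X + (e : ℝ) / (k + e : ℕ) * X := by gcongr
        _ = X := by rw [← add_mul, hsum1, one_mul]

/-- Blei's inequality, in a form tailored to arrays indexed by `d`-sets: the `ℓ_{2d/(d+1)}` norm is
controlled by the mixed norms with `ℓ_{2j/(j+1)}` on `j`-sets outside and `ℓ_2` inside. -/
lemma sum_rpow_le_of_mixed_le {n k d : ℕ} (hk : 1 ≤ k) (hkd : k ≤ d) {L : ℝ} (hL : 1 ≤ L)
    (a : Finset (Fin n) → ℝ) (hhom : ∀ S, S.card ≠ d → a S = 0)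
    (hmix : ∀ j ∈ Ico k (2 * k), ∑ J ∈ powersetCard j univ,
      (∑ S, if J ⊆ S then a S ^ 2 else 0) ^ ((j : ℝ) / (j + 1)) ≤ L) :
    ∑ S, |a S| ^ ((2 * d : ℝ) / (d + 1)) ≤ k * L ^ 2 := by
  set l : Finset (Fin n) → ℝ := fun J => ∑ S, if J ⊆ S then a S ^ 2 else 0 with hl
  have hl0 : ∀ J, 0 ≤ l J := fun J => sum_nonneg fun S _ => by positivity
  set v : Finset (Fin n) → ℝ := fun J => l J ^ ((1 : ℝ) / (J.card + 1)) with hv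
  have hv0 : ∀ J, 0 ≤ v J := fun J => Real.rpow_nonneg (hl0 J) _
  obtain ⟨V, hV0, hVL, hV⟩ := exists_block_weight hk hL v hv0 (fun j hj => by
    refine le_of_eq_of_le (sum_congr rfl fun J hJ => ?_) (hmix j hj)
    rw [hv]
    simp only [(mem_powersetCard.1 hJ).2]
    rw [← Real.rpow_mul_natCast (hl0 J)]
    congr 1
    ring) d hkd
  have hd0 : (0 : ℝ) < d := by exact_mod_cast hk.trans hkd
  set T : Finset (Finset (Fin n)) := univ.filter fun S => a S ≠ 0 with hT
  have hTd : ∀ S ∈ T, S.card = d := fun S hS => by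
    by_contra hne
    exact (mem_filter.1 hS).2 (hhom S hne)
  have hlpos : ∀ S ∈ T, ∀ J ⊆ S, 0 < l J := fun S hS J hJ => by
    have h1 : a S ^ 2 ≤ l J := by
      have := single_le_sum (f := fun S => if J ⊆ S then a S ^ 2 else 0)
        (fun S _ => by positivity) (mem_univ S)
      simpa [hJ] using this
    exact lt_of_lt_of_le (by have := (mem_filter.1 hS).2; positivity) h1
  have hVT : ∀ S ∈ T, 0 < V S ∧
      (V S)⁻¹ ≤ ∑ J ∈ S.powerset with J.card ∈ Ico k (2 * k), (v J)⁻¹ := fun S hS =>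
    hV S (hTd S hS) fun J hJ _ => Real.rpow_pos_of_pos (hlpos S hS J hJ) _
  have hT1 : ∑ S, |a S| ^ ((2 * d : ℝ) / (d + 1)) = ∑ S ∈ T, |a S| ^ ((2 * d : ℝ) / (d + 1)) := by
    refine (sum_subset (subset_univ T) fun S _ hS => ?_).symm
    have : a S = 0 := by simpa [hT] using hS
    rw [this, abs_zero, Real.zero_rpow (by positivity)]
  have hT2 : ∑ S ∈ T, |a S| ^ ((2 * d : ℝ) / (d + 1)) =
      ∑ S ∈ T, (a S ^ 2 * (V S)⁻¹) ^ ((d : ℝ) / (d + 1)) * (V S ^ d) ^ ((1 : ℝ) / (d + 1)) := by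
    refine sum_congr rfl fun S hS => ?_
    have hVS := (hVT S hS).1
    rw [Real.mul_rpow (sq_nonneg _) (inv_nonneg.2 hVS.le), Real.inv_rpow hVS.le,
      ← Real.rpow_natCast (V S), ← Real.rpow_mul hVS.le, mul_one_div, mul_assoc,
      inv_mul_cancel₀ (by positivity), mul_one, ← sq_abs, ← Real.rpow_natCast,
      ← Real.rpow_mul (abs_nonneg _)]
    congr 1
    push_cast
    ring
  have hw : ∑ S ∈ T, V S ^ d ≤ L ^ d := by
    refine le_trans (sum_le_sum_of_subset_of_nonneg (fun S hS => ?_)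
      fun S _ _ => pow_nonneg (hV0 S) d) hVL
    exact mem_powersetCard.2 ⟨subset_univ _, hTd S hS⟩
  have hu : ∑ S ∈ T, a S ^ 2 * (V S)⁻¹ ≤ k * L := by
    calc ∑ S ∈ T, a S ^ 2 * (V S)⁻¹
        ≤ ∑ S ∈ T, a S ^ 2 * ∑ J ∈ S.powerset with J.card ∈ Ico k (2 * k), (v J)⁻¹ :=
          sum_le_sum fun S hS => mul_le_mul_of_nonneg_left (hVT S hS).2 (sq_nonneg _)
      _ ≤ ∑ S, a S ^ 2 * ∑ J ∈ S.powerset with J.card ∈ Ico k (2 * k), (v J)⁻¹ :=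
          sum_le_sum_of_subset_of_nonneg (subset_univ T) fun S _ _ =>
            mul_nonneg (sq_nonneg _) (sum_nonneg fun J _ => inv_nonneg.2 (hv0 J))
      _ = ∑ J with J.card ∈ Ico k (2 * k), (v J)⁻¹ * l J := by
          simp_rw [hl, mul_sum]
          rw [sum_comm' (t' := univ.filter fun J : Finset (Fin n) => J.card ∈ Ico k (2 * k))
            (s' := fun J => univ.filter fun S => J ⊆ S) (by simp)]
          refine sum_congr rfl fun J _ => ?_
          rw [sum_filter]
          refine sum_congr rfl fun S _ => ?_
          split_ifs <;> ring
      _ = ∑ j ∈ Ico k (2 * k), ∑ J ∈ powersetCard j univ, (v J)⁻¹ * l J := by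
          rw [← sum_fiberwise_of_maps_to (t := Ico k (2 * k)) (g := card)
            fun J hJ => (mem_filter.1 hJ).2]
          refine sum_congr rfl fun j hj => sum_congr ?_ fun _ _ => rfl
          ext J
          simp only [mem_filter, mem_univ, true_and, mem_powersetCard, subset_univ]
          exact ⟨fun h => h.2, fun h => ⟨h ▸ hj, h⟩⟩
      _ ≤ ∑ _j ∈ Ico k (2 * k), L := by
          refine sum_le_sum fun j hj => ?_
          refine le_of_eq_of_le (sum_congr rfl fun J hJ => ?_) (hmix j hj)
          have hj0 : (0 : ℝ) < j := by exact_mod_cast hk.trans (mem_Ico.1 hj).1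
          rw [hv]
          simp only [(mem_powersetCard.1 hJ).2]
          change _ = l J ^ ((j : ℝ) / (j + 1))
          rcases (hl0 J).eq_or_lt with h0 | hpos
          · rw [← h0, Real.zero_rpow (by positivity), Real.zero_rpow (by positivity), mul_zero]
          · rw [← Real.rpow_neg hpos.le, ← Real.rpow_add_one hpos.ne']
            congr 1
            field_simp
            ring
      _ = k * L := by
          rw [sum_const, Nat.card_Ico, nsmul_eq_mul, show 2 * k - k = k by lia]
  have hk1 : (1 : ℝ) ≤ k := by exact_mod_cast hk
  have holder := sum_rpow_mul_rpow_pow_le T (fun S => a S ^ 2 * (V S)⁻¹) (fun S => V S ^ d)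
    (fun S _ => mul_nonneg (sq_nonneg _) (inv_nonneg.2 (hV0 S))) (fun S _ => pow_nonneg (hV0 S) d)
    d (hk.trans hkd)
  rw [← hT2, ← hT1] at holder
  have hu0 : 0 ≤ ∑ S ∈ T, a S ^ 2 * (V S)⁻¹ :=
    sum_nonneg fun S _ => mul_nonneg (sq_nonneg _) (inv_nonneg.2 (hV0 S))
  refine le_of_pow_le_pow_left₀ (Nat.succ_ne_zero d) (by positivity) (holder.trans ?_)
  calc _ ≤ (k * L) ^ d * L ^ d :=
        mul_le_mul (pow_le_pow_left₀ hu0 hu d) hw (sum_nonneg fun S _ => pow_nonneg (hV0 S) d)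
          (by positivity)
    _ = (k * L ^ 2) ^ d := by rw [← mul_pow]; ring
    _ ≤ (k * L ^ 2) ^ (d + 1) := by
        refine pow_le_pow_right₀ ?_ (Nat.le_succ d)
        nlinarith

/-- The recursion behind the subexponential bound: the inequality in degrees `[k, 2k)` yields the
inequality in degree `d ≥ k`. -/
lemma bhBound_of_forall_Ico {k d : ℕ} (hk : 1 ≤ k) (hkd : k ≤ d) {B : ℝ} (hB1 : 1 ≤ B)
    (hB : ∀ j ∈ Ico k (2 * k), BHBound j B) :
    BHBound d (k * (9 ^ ((d : ℝ) / k) * ((9 * (d : ℝ) ^ (6 * k)) ^ 2 * B)) ^ 2) := by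
  intro n a hhom ha
  have hd : 1 ≤ d := hk.trans hkd
  have hd' : (1 : ℝ) ≤ d := by exact_mod_cast hd
  have hk0 : (0 : ℝ) < k := by exact_mod_cast hk
  refine sum_rpow_le_of_mixed_le hk hkd ?_ a hhom fun j hj => ?_
  · have h1 : (1 : ℝ) ≤ 9 ^ ((d : ℝ) / k) := Real.one_le_rpow (by norm_num) (by positivity)
    have h2 : (1 : ℝ) ≤ (9 * (d : ℝ) ^ (6 * k)) ^ 2 :=
      one_le_pow₀ (by linarith [one_le_pow₀ hd' (n := 6 * k)])
    exact one_le_mul_of_one_le_of_one_le h1 (one_le_mul_of_one_le_of_one_le h2 hB1)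
  · obtain ⟨hj1, hj2⟩ := mem_Ico.1 hj
    refine ((hB j hj).sum_mixed_le (hk.trans hj1) hd a hhom ha).trans ?_
    have hj1' : (k : ℝ) ≤ j := by exact_mod_cast hj1
    have hpow : (d : ℝ) ^ (3 * j) ≤ (d : ℝ) ^ (6 * k) := pow_le_pow_right₀ hd' (by lia)
    have hrpow : (9 : ℝ) ^ ((d : ℝ) / (j + 1)) ≤ 9 ^ ((d : ℝ) / k) :=
      Real.rpow_le_rpow_of_exponent_le (by norm_num) (by gcongr; linarith)
    have hsq : (9 * (d : ℝ) ^ (3 * j)) ^ 2 ≤ (9 * (d : ℝ) ^ (6 * k)) ^ 2 :=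
      pow_le_pow_left₀ (by positivity) (by linarith) 2
    exact mul_le_mul hrpow (mul_le_mul_of_nonneg_right hsq (by linarith)) (by positivity)
      (by positivity)

end Recursion

section MainTheorem

lemma BHBound.mono {d : ℕ} {B B' : ℝ} (h : BHBound d B) (hB : B ≤ B') : BHBound d B' :=
  fun n a hhom ha => (h n a hhom ha).trans hB

/-- One step of the recursion starting from degree one gives an exponential-type bound. -/
lemma bhBound_exponential {j : ℕ} (hj : 1 ≤ j) : BHBound j ((9 ^ j * (9 * (j : ℝ) ^ 6) ^ 2) ^ 2) := by
  have h := bhBound_of_forall_Ico le_rfl hj le_rfl fun i hi => by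
    obtain rfl : i = 1 := by
      have := mem_Ico.1 hi
      lia
    exact bhBound_one
  refine h.mono (le_of_eq ?_)
  simp

/-- Two steps of the recursion, the second one with blocks of length `k ≈ √(d / log d)`. -/
lemma bhBound_two_step {k d : ℕ} (hk : 1 ≤ k) (hkd : k ≤ d) (hd : 2 ≤ d) :
    BHBound d (9 ^ (2 * (d : ℝ) / k) * (d : ℝ) ^ (201 * k)) := by
  have hd2 : (2 : ℝ) ≤ d := by exact_mod_cast hd
  have hd1 : (1 : ℝ) ≤ d := by linarith
  have h9 : (9 : ℝ) ≤ (d : ℝ) ^ 4 :=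
    le_trans (by norm_num) (pow_le_pow_left₀ (by norm_num) hd2 4)
  have hB : ∀ j ∈ Ico k (2 * k), BHBound j ((d : ℝ) ^ (80 * k)) := by
    intro j hj
    obtain ⟨hj1, hj2⟩ := mem_Ico.1 hj
    refine (bhBound_exponential (hk.trans hj1)).mono ?_
    have hjd : (j : ℝ) ≤ (d : ℝ) ^ 2 := by
      have : j ≤ d ^ 2 := by nlinarith
      exact_mod_cast this
    calc ((9 : ℝ) ^ j * (9 * (j : ℝ) ^ 6) ^ 2) ^ 2
        ≤ (((d : ℝ) ^ 4) ^ j * ((d : ℝ) ^ 4 * ((d : ℝ) ^ 2) ^ 6) ^ 2) ^ 2 := by gcongr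
      _ = (d : ℝ) ^ (8 * j + 64) := by ring
      _ ≤ (d : ℝ) ^ (80 * k) := pow_le_pow_right₀ hd1 (by lia)
  refine (bhBound_of_forall_Ico hk hkd (one_le_pow₀ hd1) hB).mono ?_
  have hkd' : (k : ℝ) ≤ d := by exact_mod_cast hkd
  calc (k : ℝ) * (9 ^ ((d : ℝ) / k) * ((9 * (d : ℝ) ^ (6 * k)) ^ 2 * (d : ℝ) ^ (80 * k))) ^ 2
      ≤ d * (9 ^ ((d : ℝ) / k) * (((d : ℝ) ^ 4 * (d : ℝ) ^ (6 * k)) ^ 2 *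
          (d : ℝ) ^ (80 * k))) ^ 2 := by gcongr
    _ = (9 ^ ((d : ℝ) / k)) ^ 2 * (d : ℝ) ^ (184 * k + 17) := by ring
    _ ≤ (9 ^ ((d : ℝ) / k)) ^ 2 * (d : ℝ) ^ (201 * k) := by
        gcongr
        lia
    _ = _ := by
        rw [← Real.rpow_natCast (9 ^ ((d : ℝ) / k)), ← Real.rpow_mul (by norm_num)]
        congr 2
        push_cast
        ring

lemma bhBound_subexponential {d : ℕ} (hd : 1 ≤ d) :
    BHBound d (Real.exp 213 ^ √(d * Real.log d)) := by
  rcases hd.eq_or_lt with rfl | hd2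
  · simpa using bhBound_one
  have hd2' : (2 : ℝ) ≤ d := by exact_mod_cast hd2
  have hd0 : (0 : ℝ) < d := by linarith
  have hlog : 1 / 2 ≤ Real.log d := by
    have := Real.log_two_gt_d9
    have := Real.log_le_log (by norm_num) hd2'
    linarith
  have hlog0 : 0 < Real.log d := by linarith
  have hlogd : Real.log d ≤ d := (Real.log_le_sub_one_of_pos hd0).trans (by linarith)
  set r : ℝ := √(d / Real.log d) with hr
  set s : ℝ := √(d * Real.log d) with hs
  have hr1 : 1 ≤ r := by
    rw [hr, Real.one_le_sqrt, one_le_div hlog0]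
    exact hlogd
  have hrd : r ≤ d := by
    rw [hr, Real.sqrt_le_left hd0.le, div_le_iff₀ hlog0]
    nlinarith
  have hs0 : 0 ≤ s := Real.sqrt_nonneg _
  have hrs : r * s = d := by
    rw [hr, hs, ← Real.sqrt_mul (by positivity), show (d : ℝ) / Real.log d * (d * Real.log d) =
      d ^ 2 by field_simp, Real.sqrt_sq hd0.le]
  have hrlog : r * Real.log d = s := by
    rw [hs, show (d : ℝ) * Real.log d = d / Real.log d * Real.log d ^ 2 by field_simp,
      Real.sqrt_mul (by positivity), Real.sqrt_sq hlog0.le]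
  set k : ℕ := ⌊r⌋₊ with hk
  have hk1 : 1 ≤ k := Nat.le_floor (by simpa using hr1)
  have hk1' : (1 : ℝ) ≤ k := by exact_mod_cast hk1
  have hkr : (k : ℝ) ≤ r := Nat.floor_le (by linarith)
  have hkr' : r ≤ 2 * k := by
    have := Nat.lt_floor_add_one r
    linarith
  have hkd : k ≤ d := by exact_mod_cast hkr.trans hrd
  refine (bhBound_two_step hk1 hkd hd2).mono ?_
  have h1 : 2 * (d : ℝ) / k ≤ 4 * s := by
    rw [div_le_iff₀ (by linarith), ← hrs]
    nlinarith
  have h2 : (k : ℝ) * Real.log d ≤ s := by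
    rw [← hrlog]
    gcongr
  have h9 : (9 : ℝ) ≤ Real.exp 3 := by
    have h := pow_le_pow_left₀ (by norm_num) Real.exp_one_gt_d9.le 3
    rw [← Real.exp_nat_mul] at h
    norm_num at h
    linarith
  calc (9 : ℝ) ^ (2 * (d : ℝ) / k) * (d : ℝ) ^ (201 * k)
      ≤ Real.exp 3 ^ (4 * s) * Real.exp (201 * (k * Real.log d)) := by
        refine mul_le_mul ?_ (le_of_eq ?_) (by positivity) (by positivity)
        · exact (Real.rpow_le_rpow_of_exponent_le (by norm_num) h1).trans
            (Real.rpow_le_rpow (by norm_num) h9 (by positivity))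
        · rw [← Real.rpow_natCast, Real.rpow_def_of_pos hd0]
          congr 1
          push_cast
          ring
    _ ≤ Real.exp 3 ^ (4 * s) * Real.exp (201 * s) := by gcongr
    _ = Real.exp 213 ^ s := by
        rw [← Real.exp_mul, ← Real.exp_mul, ← Real.exp_add]
        congr 1
        ring

lemma sum_walsh_mul_walsh {n : ℕ} (x y : Fin n → Bool) :
    ∑ S, walsh S x * walsh S y = if x = y then 2 ^ n else 0 := by
  have e : ∑ S, walsh S x * walsh S y =
      ∏ i, (1 + (if x i then (1 : ℝ) else -1) * (if y i then 1 else -1)) := by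
    rw [prod_one_add, powerset_univ]
    exact sum_congr rfl fun S _ => prod_mul_distrib.symm
  rw [e]
  split_ifs with h
  · subst h
    rw [prod_congr rfl (g := fun _ => (2 : ℝ)) fun i _ => by split_ifs <;> norm_num]
    simp
  · obtain ⟨i, hi⟩ := Function.ne_iff.1 h
    refine prod_eq_zero (mem_univ i) ?_
    cases hx : x i <;> cases hy : y i <;> simp_all

lemma sum_walshCoeff_mul_walsh {n : ℕ} (f : (Fin n → Bool) → ℝ) (x : Fin n → Bool) :
    ∑ S, walshCoeff f S * walsh S x = f x := by
  calc ∑ S, walshCoeff f S * walsh S x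
      = ∑ S, ∑ y, f y / 2 ^ n * (walsh S y * walsh S x) := by
        refine sum_congr rfl fun S _ => ?_
        rw [walshCoeff, sum_div, sum_mul]
        exact sum_congr rfl fun y _ => by ring
    _ = ∑ y, f y / 2 ^ n * ∑ S, walsh S y * walsh S x := by
        rw [sum_comm]
        exact sum_congr rfl fun y _ => (mul_sum _ _ _).symm
    _ = f x := by
        simp [sum_walsh_mul_walsh]

lemma abs_le_supNorm {n : ℕ} (f : (Fin n → Bool) → ℝ) (x : Fin n → Bool) : |f x| ≤ supNorm f :=
  le_ciSup (f := fun x => |f x|) (Set.finite_range _).bddAbove x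

/-- Bohnenblust–Hille inequality for `d`-homogeneous functions on the Boolean cube,
with subexponential constant `C^{√(d log d)}`. -/
theorem bh_boolean_homogeneous :
    ∃ C > (0 : ℝ), ∀ (d n : ℕ), 1 ≤ d → ∀ f : (Fin n → Bool) → ℝ,
      (∀ S : Finset (Fin n), S.card ≠ d → walshCoeff f S = 0) →
      (∑ S ∈ Finset.univ.filter (fun S : Finset (Fin n) => S.card = d),
          |walshCoeff f S| ^ ((2 * d : ℝ) / (d + 1))) ^ ((d + 1 : ℝ) / (2 * d))
        ≤ C ^ Real.sqrt (d * Real.log d) * supNorm f := by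
  refine ⟨Real.exp 213, Real.exp_pos _, fun d n hd f hhom => ?_⟩
  have hd' : (1 : ℝ) ≤ d := by exact_mod_cast hd
  have hp0 := two_mul_div_add_one_pos hd
  set p : ℝ := (2 * d : ℝ) / (d + 1) with hp
  set B : ℝ := Real.exp 213 ^ √(d * Real.log d) with hB
  have hq : (d + 1 : ℝ) / (2 * d) = p⁻¹ := by rw [hp, inv_div]
  have hq1 : p⁻¹ ≤ 1 := by
    rw [← hq, div_le_one (by linarith)]
    linarith
  have hB1 : 1 ≤ B := Real.one_le_rpow (Real.one_le_exp (by norm_num)) (Real.sqrt_nonneg _)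
  have hM0 : 0 ≤ supNorm f := (abs_nonneg _).trans (abs_le_supNorm f fun _ => true)
  rw [hq]
  rcases hM0.eq_or_lt with h0 | hM
  · have hf : ∀ x, f x = 0 := fun x => abs_nonpos_iff.1 (h0 ▸ abs_le_supNorm f x)
    simp [walshCoeff, hf, ← h0, Real.zero_rpow hp0.ne', Real.zero_rpow (inv_pos.2 hp0).ne']
  have hmain := bhBound_subexponential hd n (fun S => walshCoeff f S / supNorm f)
    (fun S hS => by simp [hhom S hS]) (fun x => by
      simp_rw [div_mul_eq_mul_div]
      rw [← sum_div, sum_walshCoeff_mul_walsh, abs_div, abs_of_pos hM, div_le_one hM]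
      exact abs_le_supNorm f x)
  have hsum : ∑ S, |walshCoeff f S / supNorm f| ^ p =
      (∑ S, |walshCoeff f S| ^ p) / supNorm f ^ p := by
    rw [sum_div]
    refine sum_congr rfl fun S _ => ?_
    rw [abs_div, abs_of_pos hM, Real.div_rpow (abs_nonneg _) hM0]
  rw [hsum, div_le_iff₀ (by positivity)] at hmain
  calc _ ≤ (B * supNorm f ^ p) ^ p⁻¹ := by
        refine Real.rpow_le_rpow (sum_nonneg fun _ _ => by positivity) ?_ (inv_pos.2 hp0).le
        refine le_trans ?_ hmain
        exact sum_le_sum_of_subset_of_nonneg (filter_subset _ _) fun _ _ _ => by positivity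
    _ = B ^ p⁻¹ * supNorm f := by
        rw [Real.mul_rpow (by positivity) (by positivity), Real.rpow_rpow_inv hM0 hp0.ne']
    _ ≤ B * supNorm f := by
        gcongr
        exact Real.rpow_le_self_of_one_le hB1 hq1

end MainTheorem
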